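/- arXiv:2405.02202 — 3 statements merged into one kernel-verified Lean document; each statement's English description precedes it below -/
import Mathlib

section
/- Let G be a finite simple graph and let k ≥ 1. Then G is Z_{2^k}-AW if and only if G is Z_2-AW. -/
-- Toggling a vertex `v` in the `ZMod m`-labeling lights out game:
-- the label of `v` is added to the labels of `v` and all its neighbors.
open Classical in
noncomputable def gToggle {V : Type*} (G : SimpleGraph V) {m : ℕ} (v : V)
    (lab : V → ZMod m) : V → ZMod m :=
  fun w => if w = v ∨ G.Adj v w then lab v + lab w else lab w

/-- The result of toggling, in order, the vertices in the list `L`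
in the `ZMod m`-labeling lights out game. -/
noncomputable def gPlay {V : Type*} (G : SimpleGraph V) {m : ℕ} (L : List V)
    (lab : V → ZMod m) : V → ZMod m :=
  L.foldl (fun l v => gToggle G v l) lab

/-- A labeling is winnable in the `ZMod m`-labeling lights out game if some
finite sequence of toggles transforms it into the zero labeling. -/
def gWinnable {V : Type*} (G : SimpleGraph V) {m : ℕ} (lab : V → ZMod m) : Prop :=
  ∃ L : List V, gPlay G L lab = 0

/-- `G` is `ZMod m`-Always Winnable: every labeling is winnable
in the `ZMod m`-labeling lights out game. -/
def gAW {V : Type*} (G : SimpleGraph V) (m : ℕ) : Prop :=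
  ∀ lab : V → ZMod m, gWinnable G lab

-- Toggling a vertex `v` in the neighborhood `m`-lights out game:
-- the labels of `v` and all its neighbors are increased by `1`.
open Classical in
noncomputable def nToggle {V : Type*} (G : SimpleGraph V) {m : ℕ} (v : V)
    (lab : V → ZMod m) : V → ZMod m :=
  fun w => if w = v ∨ G.Adj v w then lab w + 1 else lab w

/-- The result of toggling, in order, the vertices in the list `L`
in the neighborhood `m`-lights out game. -/
noncomputable def nPlay {V : Type*} (G : SimpleGraph V) {m : ℕ} (L : List V)
    (lab : V → ZMod m) : V → ZMod m :=
  L.foldl (fun l v => nToggle G v l) lab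

/-- A labeling is `(N,m)`-winnable if some finite sequence of toggles in the
neighborhood `m`-lights out game transforms it into the zero labeling. -/
def nWinnable {V : Type*} (G : SimpleGraph V) {m : ℕ} (lab : V → ZMod m) : Prop :=
  ∃ L : List V, nPlay G L lab = 0

/-- `G` is `(N,m)`-Always Winnable: every labeling is winnable
in the neighborhood `m`-lights out game. -/
def nAW {V : Type*} (G : SimpleGraph V) (m : ℕ) : Prop :=
  ∀ lab : V → ZMod m, nWinnable G lab

/-- The parity of an element of `ZMod n`, as an element of `ZMod 2`:
`1` if its representatives are odd, `0` if they are even. -/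
def parity {n : ℕ} (x : ZMod n) : ZMod 2 :=
  if x.val % 2 = 1 then 1 else 0

/-- Playing a fixed sequence of toggles commutes with additive maps of the label groups. -/
theorem gPlay_map {V : Type*} (G : SimpleGraph V) {m n : ℕ} (f : ZMod m →+ ZMod n)
    (L : List V) (lab : V → ZMod m) :
    gPlay G L (fun v => f (lab v)) = fun v => f (gPlay G L lab v) := by
  induction L generalizing lab with
  | nil => rfl
  | cons v L ih =>
    have h : gToggle G v (fun w => f (lab w)) = fun w => f (gToggle G v lab w) := by
      funext w
      simp only [gToggle]
      split_ifs <;> simp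
    change gPlay G L (gToggle G v fun w => f (lab w)) = _
    rw [h, ih]
    rfl

/-- The labeling game played with integer labels. -/
noncomputable def intPlay {V : Type*} (G : SimpleGraph V) (L : List V) (lab : V → ℤ) : V → ℤ :=
  gPlay G (m := 0) L lab

theorem gPlay_intCast {V : Type*} (G : SimpleGraph V) (m : ℕ) (L : List V) (lab : V → ℤ) :
    gPlay G L (fun v => (lab v : ZMod m)) = fun v => (intPlay G L lab v : ZMod m) :=
  gPlay_map G (m := 0) (Int.castAddHom (ZMod m)) L lab

theorem intPlay_mul_left {V : Type*} (G : SimpleGraph V) (c : ℤ) (L : List V) (lab : V → ℤ) :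
    intPlay G L (fun v => c * lab v) = fun v => c * intPlay G L lab v :=
  gPlay_map G (m := 0) (n := 0) (AddMonoidHom.mulLeft c) L lab

theorem intPlay_append {V : Type*} (G : SimpleGraph V) (L₁ L₂ : List V) (lab : V → ℤ) :
    intPlay G (L₁ ++ L₂) lab = intPlay G L₂ (intPlay G L₁ lab) :=
  List.foldl_append

theorem gPlay_intCast_eq_zero_iff {V : Type*} (G : SimpleGraph V) (m : ℕ) (L : List V)
    (lab : V → ℤ) :
    gPlay G L (fun v => (lab v : ZMod m)) = 0 ↔ ∀ v, (m : ℤ) ∣ intPlay G L lab v := by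
  rw [gPlay_intCast, funext_iff]
  exact forall_congr' fun v => ZMod.intCast_zmod_eq_zero_iff_dvd _ m

/-- A graph is `ZMod m`-AW iff every integer labeling can be made divisible by `m`. -/
theorem gAW_iff_int {V : Type*} (G : SimpleGraph V) (m : ℕ) :
    gAW G m ↔ ∀ lab : V → ℤ, ∃ L : List V, ∀ v, (m : ℤ) ∣ intPlay G L lab v := by
  constructor
  · intro h lab
    obtain ⟨L, hL⟩ := h fun v => (lab v : ZMod m)
    exact ⟨L, (gPlay_intCast_eq_zero_iff G m L lab).1 hL⟩
  · intro h lab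
    choose lift hlift using fun v => ZMod.intCast_surjective (lab v)
    obtain ⟨L, hL⟩ := h lift
    refine ⟨L, ?_⟩
    rw [← funext hlift]
    exact (gPlay_intCast_eq_zero_iff G m L lift).2 hL

theorem gAW.of_dvd {V : Type*} {G : SimpleGraph V} {m n : ℕ} (h : gAW G n) (hmn : m ∣ n) :
    gAW G m := by
  rw [gAW_iff_int] at h ⊢
  intro lab
  obtain ⟨L, hL⟩ := h lab
  exact ⟨L, fun v => (Int.natCast_dvd_natCast.2 hmn).trans (hL v)⟩

theorem gAW.mul {V : Type*} {G : SimpleGraph V} {m n : ℕ} (hm : gAW G m) (hn : gAW G n) :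
    gAW G (m * n) := by
  rw [gAW_iff_int] at hm hn ⊢
  intro lab
  obtain ⟨L₁, hL₁⟩ := hm lab
  choose quot hquot using hL₁
  obtain ⟨L₂, hL₂⟩ := hn quot
  refine ⟨L₁ ++ L₂, fun v => ?_⟩
  rw [intPlay_append, funext hquot, intPlay_mul_left, Nat.cast_mul]
  exact mul_dvd_mul_left (m : ℤ) (hL₂ v)

theorem gAW.pow {V : Type*} {G : SimpleGraph V} {m : ℕ} (h : gAW G m) (k : ℕ) :
    gAW G (m ^ k) := by
  induction k with
  | zero => exact h.of_dvd (one_dvd m)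
  | succ k ih => exact ih.mul h

theorem stmt4 {V : Type*} [Fintype V] (G : SimpleGraph V) (k : ℕ) (hk : 1 ≤ k) :
    gAW G (2 ^ k) ↔ gAW G 2 :=
  ⟨fun h => h.of_dvd (dvd_pow_self 2 (by omega)), fun h => h.pow k⟩
end

section
/- Let n ≥ 3 and k ≥ 1. If the cycle graph C_n is Z_{2^k}-AW, then n ≡ 1 or 2 (mod 3). -/
open Classical in
/-- If a weight `c : V → R` sums to zero over every closed neighborhood, then toggling preserves
the `c`-weighted sum of the labels, reduced to `R`. -/
theorem weightedSum_gToggle {V R : Type*} [Fintype V] [CommRing R] (G : SimpleGraph V) {m : ℕ}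
    (φ : ZMod m →+* R) (c : V → R)
    (hc : ∀ v, ∑ w, (if w = v ∨ G.Adj v w then c w else 0) = 0) (v : V) (lab : V → ZMod m) :
    ∑ w, c w * φ (gToggle G v lab w) = ∑ w, c w * φ (lab w) := by
  have h : ∀ w, c w * φ (gToggle G v lab w) =
      φ (lab v) * (if w = v ∨ G.Adj v w then c w else 0) + c w * φ (lab w) := by
    intro w
    unfold gToggle
    split_ifs
    · rw [map_add]; ring
    · ring
  simp only [h, Finset.sum_add_distrib, ← Finset.mul_sum, hc v, mul_zero, zero_add]

open Classical in
theorem weightedSum_gPlay {V R : Type*} [Fintype V] [CommRing R] (G : SimpleGraph V) {m : ℕ}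
    (φ : ZMod m →+* R) (c : V → R)
    (hc : ∀ v, ∑ w, (if w = v ∨ G.Adj v w then c w else 0) = 0) (L : List V)
    (lab : V → ZMod m) :
    ∑ w, c w * φ (gPlay G L lab w) = ∑ w, c w * φ (lab w) := by
  induction L generalizing lab with
  | nil => rfl
  | cons v L ih => exact (ih (gToggle G v lab)).trans (weightedSum_gToggle G φ c hc v lab)

open Classical in
/-- A graph with a nonzero weight summing to zero over every closed neighborhood
is not always winnable. -/
theorem not_gAW_of_closedNeighborhood_sum_eq_zero {V R : Type*} [Fintype V] [CommRing R]
    (G : SimpleGraph V) {m : ℕ} (φ : ZMod m →+* R) (c : V → R)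
    (hc : ∀ v, ∑ w, (if w = v ∨ G.Adj v w then c w else 0) = 0) {u : V} (hu : c u ≠ 0) :
    ¬ gAW G m := by
  intro hAW
  obtain ⟨L, hL⟩ := hAW (Pi.single u 1)
  have h := weightedSum_gPlay G φ c hc L (Pi.single u 1)
  have hsum : ∑ w, c w * φ (Pi.single (M := fun _ => ZMod m) u 1 w) = c u := by
    rw [Finset.sum_eq_single u (fun w _ hw => by simp [Pi.single_eq_of_ne hw]) (by simp)]
    simp
  exact hu (by simpa [hL, hsum] using h.symm)

/-- A closed neighborhood of `cycleGraph n` consists of three consecutive vertices. -/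
theorem cycleGraph_closedNeighborhood_sum {R : Type*} [AddCommMonoid R] (n : ℕ)
    (c : Fin (n + 3) → R) (i : Fin (n + 3)) :
    ∑ w, (if w = i ∨ (SimpleGraph.cycleGraph (n + 3)).Adj i w then c w else 0) =
      c i + (c (i - 1) + c (i + 1)) := by
  have hset : (Finset.univ.filter fun w => w = i ∨ (SimpleGraph.cycleGraph (n + 3)).Adj i w) =
      {i, i - 1, i + 1} := by
    ext w
    have h := SimpleGraph.cycleGraph_neighborSet (n := n + 1) (v := i)
    have hw : (SimpleGraph.cycleGraph (n + 3)).Adj i w ↔ w = i - 1 ∨ w = i + 1 := by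
      rw [← SimpleGraph.mem_neighborSet, h]; simp
    simp [hw]
  have hone : (1 : Fin (n + 3)) ≠ 0 := by simp
  have htwo : (1 : Fin (n + 3)) + 1 ≠ 0 := by
    simp [Fin.ext_iff, Fin.val_add, Nat.mod_eq_of_lt]
  rw [← Finset.sum_filter, hset, Finset.sum_insert, Finset.sum_pair]
  · intro h
    exact htwo (by rw [← sub_eq_zero] at h; rw [← neg_eq_zero, ← h]; abel)
  · simp only [Finset.mem_insert, Finset.mem_singleton, not_or]
    exact ⟨fun h => hone (sub_eq_self.mp h.symm), fun h => hone (left_eq_add.mp h)⟩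

theorem stmt11 (n k : ℕ) (hn : 3 ≤ n) (hk : 1 ≤ k)
    (hAW : gAW (SimpleGraph.cycleGraph n) (2 ^ k)) :
    n % 3 = 1 ∨ n % 3 = 2 := by
  by_contra hmod
  have hn3 : n % 3 = 0 := by omega
  obtain ⟨n, rfl⟩ := Nat.exists_eq_add_of_le' hn
  let c : Fin (n + 3) → ZMod 2 := fun w => if w.val % 3 = 2 then 0 else 1
  refine not_gAW_of_closedNeighborhood_sum_eq_zero (SimpleGraph.cycleGraph (n + 3))
    (ZMod.castHom (dvd_pow_self 2 (by omega : k ≠ 0)) (ZMod 2)) c (fun i => ?_) (u := 0)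
    (by simp [c]) hAW
  trans c i + (c (i - 1) + c (i + 1))
  · convert cycleGraph_closedNeighborhood_sum n c i
  have hsucc : (i + 1).val % 3 = (i.val + 1) % 3 := by
    rw [Fin.val_add, Fin.val_one, Nat.mod_mod_of_dvd _ (Nat.dvd_of_mod_eq_zero hn3)]
  have hpred : (i - 1).val % 3 = (i.val + 2) % 3 := by
    rw [Fin.val_sub, Fin.val_one, Nat.mod_mod_of_dvd _ (Nat.dvd_of_mod_eq_zero hn3)]
    omega
  have htwo : (1 + 1 : ZMod 2) = 0 := rfl
  simp only [c, hsucc, hpred]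
  have : i.val % 3 = 0 ∨ i.val % 3 = 1 ∨ i.val % 3 = 2 := by omega
  rcases this with h | h | h <;> simp [Nat.add_mod, h, htwo]
end

section
/- Let n ≥ 3 and consider the Z_2-labeling lights out game on the cycle graph C_n with vertices v_1, …, v_n. For any initial labeling of V(C_n) by Z_2, one can toggle vertices so as to achieve a labeling λ with λ(v_i) = 0 for all i ≥ 3. -/
/-- Away from the vertex `0`, adjacency in the cycle graph is adjacency in a path. -/
lemma cycleGraph_adj_iff_of_pos {n : ℕ} {v w : Fin n} (hv : 1 ≤ v.val) (hw : 1 ≤ w.val) :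
    (SimpleGraph.cycleGraph n).Adj v w ↔ v.val + 1 = w.val ∨ w.val + 1 = v.val := by
  have hvn := v.isLt
  have hwn := w.isLt
  rw [SimpleGraph.cycleGraph_adj']
  rcases lt_trichotomy v w with h | h | h
  · rw [Fin.coe_sub_iff_lt.2 h, Fin.coe_sub_iff_le.2 h.le]
    rw [Fin.lt_def] at h
    omega
  · subst h
    rw [Fin.coe_sub_iff_le.2 le_rfl]
    omega
  · rw [Fin.coe_sub_iff_lt.2 h, Fin.coe_sub_iff_le.2 h.le]
    rw [Fin.lt_def] at h
    omega

lemma gToggle_cycleGraph_of_pos {n m : ℕ} {v w : Fin n} (hv : 1 ≤ v.val) (hw : 1 ≤ w.val)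
    (lab : Fin n → ZMod m) :
    gToggle (SimpleGraph.cycleGraph n) v lab w =
      if w.val = v.val ∨ v.val + 1 = w.val ∨ w.val + 1 = v.val
        then lab v + lab w else lab w := by
  simp only [gToggle, cycleGraph_adj_iff_of_pos hv hw, Fin.ext_iff]

lemma gPlay_append {V : Type*} (G : SimpleGraph V) {m : ℕ} (L L' : List V)
    (lab : V → ZMod m) : gPlay G (L ++ L') lab = gPlay G L' (gPlay G L lab) := by
  simp [gPlay]

/-- If all labels beyond `k` vanish, then toggling can make the label of `k` vanish as well. -/
lemma exists_gPlay_cycleGraph_eq_zero_of_le {n k : ℕ} (hk : 2 ≤ k) (hkn : k < n)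
    (lab : Fin n → ZMod 2) (h : ∀ i : Fin n, k + 1 ≤ i.val → lab i = 0) :
    ∃ L : List (Fin n), ∀ i : Fin n, k ≤ i.val →
      gPlay (SimpleGraph.cycleGraph n) L lab i = 0 := by
  obtain ⟨b, hb⟩ : ∃ b : Fin n, b.val = k := ⟨⟨k, hkn⟩, rfl⟩
  obtain ⟨a, ha⟩ : ∃ a : Fin n, a.val + 1 = k := ⟨⟨k - 1, by omega⟩, by simp; omega⟩
  have ha1 : 1 ≤ a.val := by omega
  have hb1 : 1 ≤ b.val := by omega
  have two : (1 : ZMod 2) + 1 = 0 := by decide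
  have cases01 : ∀ x : ZMod 2, x = 0 ∨ x = 1 := by decide
  have eq_or_lt : ∀ i : Fin n, k ≤ i.val → i = b ∨ k + 1 ≤ i.val := fun i hi => by
    rw [Fin.ext_iff]; omega
  rcases cases01 (lab b) with hlb | hlb
  · refine ⟨[], fun i hi => ?_⟩
    rcases eq_or_lt i hi with rfl | hi'
    · exact hlb
    · exact h i hi'
  rcases cases01 (lab a) with hla | hla
  · refine ⟨[b, a, b], fun i hi => ?_⟩
    have hi1 : 1 ≤ i.val := by omega
    simp only [gPlay, List.foldl_cons, List.foldl_nil,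
      gToggle_cycleGraph_of_pos, ha1, hb1, hi1]
    rcases eq_or_lt i hi with rfl | hi'
    · simp [hb, ha, hlb, hla, two]
    · have hne : ¬ i.val = a.val := by omega
      have hne₃ : ¬ i.val + 1 = a.val := by omega
      simp only [hb, ha, hlb, hla, two, h i hi', hne, hne₃]
      split_ifs <;> simp_all
  · refine ⟨[a], fun i hi => ?_⟩
    have hi1 : 1 ≤ i.val := by omega
    simp only [gPlay, List.foldl_cons, List.foldl_nil,
      gToggle_cycleGraph_of_pos, ha1, hi1]
    rcases eq_or_lt i hi with rfl | hi'
    · simp [hb, ha, hlb, hla, two]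
    · rw [if_neg (by omega), h i hi']

theorem stmt13 (n : ℕ) (hn : 3 ≤ n) (lab : Fin n → ZMod 2) :
    ∃ L : List (Fin n), ∀ i : Fin n, 2 ≤ i.val →
      gPlay (SimpleGraph.cycleGraph n) L lab i = 0 := by
  suffices H : ∀ k, 2 ≤ k → k ≤ n → ∃ L : List (Fin n), ∀ i : Fin n, k ≤ i.val →
      gPlay (SimpleGraph.cycleGraph n) L lab i = 0 from H 2 le_rfl (by omega)
  intro k hk hkn
  induction hkn using Nat.decreasingInduction with
  | self => exact ⟨[], fun i hi => absurd i.isLt (by omega)⟩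
  | of_succ k hkn ih =>
    obtain ⟨L, hL⟩ := ih (by omega)
    obtain ⟨L', hL'⟩ := exists_gPlay_cycleGraph_eq_zero_of_le hk hkn _ hL
    exact ⟨L ++ L', fun i hi => by rw [gPlay_append]; exact hL' i hi⟩
end
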